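/- Quantiles of randomly centered and scaled random distributions converge under weak convergence in probability: Let (Q_n) be a sequence of random probability measures on ℝ (defined on probability spaces (Ω_n, P_n)), (u_n) positive reals, (Y_n) real random variables on Ω_n, V > 0, and δ ∈ (0,1). Let a_{n,δ} denote the δ-quantile of Q_n. If the pushforward of Q_n under x ↦ u_n(x − Y_n) converges weakly in P_n-probability to N(0, V), then u_n(a_{n,δ} − Y_n) → √V q_δ in P_n-probability, where q_δ is the δ-quantile of the standard Gaussian distribution. -/

import Mathlib

open MeasureTheory ProbabilityTheory Filter Set

/-- The bounded-Lipschitz distance between two (probability) measures on `ℝ`. -/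
noncomputable def dBL (μ ν : Measure ℝ) : ℝ :=
  ⨆ f : {f : ℝ → ℝ // LipschitzWith 1 f ∧ ∀ x, |f x| ≤ 1},
    |∫ x, f.1 x ∂μ - ∫ x, f.1 x ∂ν|

/-- The `p`-quantile of a probability measure on `ℝ`: `inf {x : Q(−∞, x] ≥ p}`. -/
noncomputable def quantile (Q : Measure ℝ) (p : ℝ) : ℝ :=
  sInf {x : ℝ | p ≤ (Q (Set.Iic x)).toReal}

/-- The set whose infimum is the `p`-quantile of a probability measure is nonempty for `p < 1`. -/
lemma quantile_set_nonempty (Q : Measure ℝ) [IsProbabilityMeasure Q] {p : ℝ} (hp : p < 1) :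
    {x : ℝ | p ≤ (Q (Set.Iic x)).toReal}.Nonempty := by
  obtain ⟨x, hx⟩ := ((tendsto_cdf_atTop Q).eventually (eventually_gt_nhds hp)).exists
  rw [cdf_eq_real] at hx
  exact ⟨x, hx.le⟩

/-- The set whose infimum is the `p`-quantile of a probability measure is bounded below for
`0 < p`. -/
lemma quantile_set_bddBelow (Q : Measure ℝ) [IsProbabilityMeasure Q] {p : ℝ} (hp : 0 < p) :
    BddBelow {x : ℝ | p ≤ (Q (Set.Iic x)).toReal} := by
  obtain ⟨x, hx⟩ := ((tendsto_cdf_atBot Q).eventually (eventually_lt_nhds hp)).exists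
  refine ⟨x, fun y hy => ?_⟩
  by_contra! h
  have hmono := monotone_cdf Q h.le
  rw [cdf_eq_real] at hmono
  exact absurd (le_trans hy hmono) (not_le.2 hx)

lemma quantile_le (Q : Measure ℝ) [IsProbabilityMeasure Q] {p b : ℝ} (hp : 0 < p)
    (hb : p ≤ Q.real (Iic b)) : quantile Q p ≤ b :=
  csInf_le (quantile_set_bddBelow Q hp) hb

lemma le_quantile (Q : Measure ℝ) [IsProbabilityMeasure Q] {p a : ℝ} (hp : p < 1)
    (ha : Q.real (Iic a) < p) : a ≤ quantile Q p := by
  refine le_csInf (quantile_set_nonempty Q hp) fun y hy => ?_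
  by_contra! h
  exact absurd (le_trans hy (measureReal_mono (Iic_subset_Iic.2 h.le))) (not_le.2 ha)

/-- Quantiles are equivariant under increasing affine maps. -/
lemma quantile_map_affine (Q : Measure ℝ) [IsProbabilityMeasure Q] {p c : ℝ} (b : ℝ)
    (hp : p ∈ Ioo (0 : ℝ) 1) (hc : 0 < c) :
    quantile (Q.map fun x => c * (x - b)) p = c * (quantile Q p - b) := by
  have hmono : Monotone fun x : ℝ => c * (x - b) := fun x y hxy => by
    dsimp only
    gcongr
  have hcont : Continuous fun x : ℝ => c * (x - b) := by fun_prop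
  have hinf := hmono.map_csInf_of_continuousAt hcont.continuousAt
    (quantile_set_nonempty Q hp.2) (quantile_set_bddBelow Q hp.1)
  refine Eq.trans ?_ hinf.symm
  unfold quantile
  congr 1
  have hIic (y : ℝ) : (fun x : ℝ => c * (x - b)) ⁻¹' Iic y = Iic (y / c + b) := by
    ext x
    simp only [mem_preimage, mem_Iic, ← sub_le_iff_le_add, le_div_iff₀ hc, mul_comm c]
  ext y
  simp only [mem_ofPred_eq, mem_image, Measure.map_apply hcont.measurable measurableSet_Iic, hIic]
  constructor
  · exact fun h => ⟨y / c + b, h, by field_simp; ring⟩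
  · rintro ⟨x, hx, rfl⟩
    rwa [mul_div_cancel_left₀ _ hc.ne', sub_add_cancel]

lemma measureReal_Iic_lt_of_lt_quantile (Q : Measure ℝ) [IsProbabilityMeasure Q] {p a : ℝ}
    (hp : 0 < p) (ha : a < quantile Q p) : Q.real (Iic a) < p := by
  by_contra! h
  exact absurd (quantile_le Q hp h) (not_le.2 ha)

lemma lt_measureReal_Iic_of_quantile_lt (Q : Measure ℝ) [IsProbabilityMeasure Q]
    [Q.IsOpenPosMeasure] {p b : ℝ} (hp : p < 1) (hb : quantile Q p < b) :
    p < Q.real (Iic b) := by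
  obtain ⟨y, hy, hyb⟩ := exists_lt_of_csInf_lt (quantile_set_nonempty Q hp) hb
  have hpos : 0 < Q.real (Ioc y b) := by
    refine ENNReal.toReal_pos (ne_of_gt ?_) (measure_ne_top _ _)
    exact (isOpen_Ioo.measure_pos Q (nonempty_Ioo.2 hyb)).trans_le
      (measure_mono Ioo_subset_Ioc_self)
  have hunion : Q.real (Iic b) = Q.real (Iic y) + Q.real (Ioc y b) := by
    rw [← Iic_union_Ioc_eq_Iic hyb.le]
    exact measureReal_union (Iic_disjoint_Ioc le_rfl) measurableSet_Ioc
  have hy' : p ≤ Q.real (Iic y) := hy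
  linarith

lemma abs_integral_sub_le_dBL (μ ν : Measure ℝ) [IsProbabilityMeasure μ] [IsProbabilityMeasure ν]
    {f : ℝ → ℝ} (hf : LipschitzWith 1 f) (hf1 : ∀ x, |f x| ≤ 1) :
    |∫ x, f x ∂μ - ∫ x, f x ∂ν| ≤ dBL μ ν := by
  have hint (ρ : Measure ℝ) [IsProbabilityMeasure ρ] {g : ℝ → ℝ} (hg : ∀ x, |g x| ≤ 1) :
      |∫ x, g x ∂ρ| ≤ 1 := by
    simpa using norm_integral_le_of_norm_le_const (μ := ρ) (f := g) (C := 1)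
      (Eventually.of_forall hg)
  refine le_ciSup (f := fun f : {f : ℝ → ℝ // LipschitzWith 1 f ∧ ∀ x, |f x| ≤ 1} =>
    |∫ x, f.1 x ∂μ - ∫ x, f.1 x ∂ν|) ⟨2, ?_⟩ ⟨f, hf, hf1⟩
  rintro _ ⟨g, rfl⟩
  dsimp only
  linarith [abs_sub (∫ x, g.1 x ∂μ) (∫ x, g.1 x ∂ν), hint μ g.2.2, hint ν g.2.2]

lemma dBL_comm (μ ν : Measure ℝ) : dBL μ ν = dBL ν μ := by
  simp only [dBL, abs_sub_comm]

/-- Distribution functions are compared, up to a shift `h`, by the bounded-Lipschitz distance. -/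
lemma mul_measureReal_Iic_le_add_dBL (μ ν : Measure ℝ) [IsProbabilityMeasure μ]
    [IsProbabilityMeasure ν] {h : ℝ} (h0 : 0 < h) (h1 : h ≤ 1) (a : ℝ) :
    h * μ.real (Iic a) ≤ h * ν.real (Iic (a + h)) + dBL μ ν := by
  set f : ℝ → ℝ := fun x => max 0 (min h (a + h - x))
  have hlip : LipschitzWith 1 f :=
    ((LipschitzWith.of_dist_le_mul fun x y => by
      rw [dist_sub_left, NNReal.coe_one, one_mul] :
        LipschitzWith 1 fun x => a + h - x).const_min h).const_max 0
  have hf0 (x : ℝ) : 0 ≤ f x := le_max_left _ _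
  have hfh (x : ℝ) : f x ≤ h := max_le h0.le (min_le_left _ _)
  have hf1 (x : ℝ) : |f x| ≤ 1 := by
    rw [abs_of_nonneg (hf0 x)]
    exact (hfh x).trans h1
  have hfint (ρ : Measure ℝ) [IsProbabilityMeasure ρ] : Integrable f ρ :=
    Integrable.of_bound hlip.continuous.aestronglyMeasurable 1 (Eventually.of_forall hf1)
  have hind (ρ : Measure ℝ) [IsProbabilityMeasure ρ] (c : ℝ) :
      Integrable ((Iic c).indicator fun _ => h) ρ :=
    (integrable_const h).indicator measurableSet_Iic
  have hindval (ρ : Measure ℝ) (c : ℝ) :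
      ∫ x, (Iic c).indicator (fun _ => h) x ∂ρ = h * ρ.real (Iic c) := by
    rw [integral_indicator_const _ measurableSet_Iic, smul_eq_mul, mul_comm]
  have hlower : h * μ.real (Iic a) ≤ ∫ x, f x ∂μ := by
    rw [← hindval]
    refine integral_mono (hind μ a) (hfint μ) (indicator_le' (fun x hx => ?_) fun x _ => hf0 x)
    rw [mem_Iic] at hx
    exact le_max_of_le_right (le_min le_rfl (by linarith))
  have hupper : ∫ x, f x ∂ν ≤ h * ν.real (Iic (a + h)) := by
    rw [← hindval]
    refine integral_mono (hfint ν) (hind ν (a + h)) fun x => ?_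
    by_cases hx : x ∈ Iic (a + h)
    · simpa [indicator_of_mem hx] using hfh x
    · rw [indicator_of_notMem hx]
      rw [mem_Iic, not_le] at hx
      exact max_le le_rfl (min_le_of_right_le (by linarith))
  linarith [le_abs_self (∫ x, f x ∂μ - ∫ x, f x ∂ν), abs_integral_sub_le_dBL μ ν hlip hf1]

/-- The quantile map is continuous, for the bounded-Lipschitz distance, at every probability
measure that charges all nonempty open sets. -/
lemma exists_pos_forall_dBL_le_abs_quantile_sub_le (ν : Measure ℝ) [IsProbabilityMeasure ν]
    [ν.IsOpenPosMeasure] {p ε : ℝ} (hp : p ∈ Ioo (0 : ℝ) 1) (hε : 0 < ε) :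
    ∃ η > 0, ∀ (μ : Measure ℝ) [IsProbabilityMeasure μ], dBL μ ν ≤ η →
      |quantile μ p - quantile ν p| ≤ ε := by
  set m := quantile ν p
  set h := min (ε / 2) 1
  have h0 : 0 < h := lt_min (by linarith) one_pos
  have h1 : h ≤ 1 := min_le_right _ _
  have hhε : h ≤ ε / 2 := min_le_left _ _
  have hlow := measureReal_Iic_lt_of_lt_quantile ν hp.1 (sub_lt_self m h0)
  have hupp := lt_measureReal_Iic_of_quantile_lt ν hp.2 (lt_add_of_pos_right m h0)
  refine ⟨min (h * (p - ν.real (Iic (m - h))) / 2) (h * (ν.real (Iic (m + h)) - p)),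
    lt_min (half_pos (mul_pos h0 (sub_pos.2 hlow))) (mul_pos h0 (sub_pos.2 hupp)),
    fun μ _ hμ => ?_⟩
  have hμ1 := hμ.trans (min_le_left _ _)
  have hμ2 := hμ.trans (min_le_right _ _)
  have hpos := mul_pos h0 (sub_pos.2 hlow)
  have hle := mul_measureReal_Iic_le_add_dBL μ ν h0 h1 (m - 2 * h)
  have hge := mul_measureReal_Iic_le_add_dBL ν μ h0 h1 (m + h)
  rw [show m - 2 * h + h = m - h by ring] at hle
  rw [show m + h + h = m + 2 * h by ring, dBL_comm] at hge
  have hq1 : m - 2 * h ≤ quantile μ p :=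
    le_quantile μ hp.2 (lt_of_mul_lt_mul_left (by linarith) h0.le)
  have hq2 : quantile μ p ≤ m + 2 * h :=
    quantile_le μ hp.1 (le_of_mul_le_mul_left (by linarith) h0)
  exact abs_le.2 ⟨by linarith, by linarith⟩

lemma isOpenPosMeasure_gaussianReal (m : ℝ) {v : NNReal} (hv : v ≠ 0) :
    (gaussianReal m v).IsOpenPosMeasure :=
  (gaussianReal_absolutelyContinuous' m hv).isOpenPosMeasure

lemma quantile_gaussianReal_zero {V p : ℝ} (hV : 0 < V) (hp : p ∈ Ioo (0 : ℝ) 1) :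
    quantile (gaussianReal 0 (Real.toNNReal V)) p = √V * quantile (gaussianReal 0 1) p := by
  have hmap : (gaussianReal 0 1).map (fun x => √V * (x - 0)) = gaussianReal 0 V.toNNReal := by
    simp only [sub_zero]
    rw [gaussianReal_map_const_mul]
    congr 1
    · simp
    · ext
      simp [Real.sq_sqrt hV.le, hV.le]
  rw [← hmap, quantile_map_affine _ _ hp (Real.sqrt_pos.2 hV), sub_zero]

/-- **Quantiles of randomly centered and scaled random distributions converge under weak
convergence in probability.** If the pushforward of the random probability measure `Qₙ`
under `x ↦ uₙ (x − Yₙ)` converges weakly in `Pₙ`-probability to `N(0, V)`, then the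
`δ`-quantile `a_{n,δ}` of `Qₙ` satisfies `uₙ(a_{n,δ} − Yₙ) → √V q_δ` in `Pₙ`-probability,
where `q_δ` is the standard Gaussian `δ`-quantile. -/
theorem quantile_convergence_of_weak_convergence_in_probability
    (Ω : ℕ → Type*) [∀ n, MeasurableSpace (Ω n)]
    (P : ∀ n, Measure (Ω n)) (hP : ∀ n, IsProbabilityMeasure (P n))
    (Q : ∀ n, Ω n → Measure ℝ) (hQprob : ∀ n ω, IsProbabilityMeasure (Q n ω))
    (u : ℕ → ℝ) (hu : ∀ n, 0 < u n)
    (Y : ∀ n, Ω n → ℝ)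
    (V : ℝ) (hV : 0 < V) (δ : ℝ) (hδ : δ ∈ Set.Ioo (0 : ℝ) 1)
    (hconv : ∀ ε > (0 : ℝ),
      Tendsto (fun n => P n {ω |
        ε < dBL (Measure.map (fun x => u n * (x - Y n ω)) (Q n ω))
          (gaussianReal 0 (Real.toNNReal V))})
        atTop (nhds 0)) :
    ∀ ε > (0 : ℝ),
      Tendsto (fun n => P n {ω |
        ε < |u n * (quantile (Q n ω) δ - Y n ω)
          - Real.sqrt V * quantile (gaussianReal 0 1) δ|})
        atTop (nhds 0) := by
  intro ε hε
  have hopen : (gaussianReal 0 V.toNNReal).IsOpenPosMeasure :=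
    isOpenPosMeasure_gaussianReal 0 (Real.toNNReal_pos.2 hV).ne'
  obtain ⟨η, hη, hquant⟩ :=
    exists_pos_forall_dBL_le_abs_quantile_sub_le (gaussianReal 0 V.toNNReal) hδ hε
  refine tendsto_of_tendsto_of_tendsto_of_le_of_le tendsto_const_nhds (hconv η hη)
    (fun _ => zero_le) fun n => measure_mono fun ω hω => ?_
  rw [mem_ofPred_eq] at hω ⊢
  by_contra! hle
  have := hQprob n ω
  have : IsProbabilityMeasure ((Q n ω).map fun x => u n * (x - Y n ω)) :=
    Measure.isProbabilityMeasure_map (by fun_prop)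
  have hfinal := hquant _ hle
  rw [quantile_map_affine _ _ hδ (hu n), quantile_gaussianReal_zero hV hδ] at hfinal
  exact absurd hfinal (not_le.2 hω)
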